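/- Under the structure conditions, the extended angle functions θ̃_i, θ̃_j, θ̃_k : ℝ³ → ℝ are well defined and continuous on all of ℝ³, where θ̃_a := θ_a on the admissible space Ω^E_{ijk}, and for f ∉ Ω^E_{ijk} one sets θ̃_a := π and θ̃_b := θ̃_c := 0 whenever l_{bc} ≥ l_{ab} + l_{ac} for the labeling {a,b,c} = {i,j,k} (for positive lengths at most one triangle inequality can fail, so this is well defined). -/

import Mathlib

open Real

/-- Euclidean discrete conformal edge length between vertices `s` and `t` of the triangle,
for scheme coefficients `ε`, conformal structure coefficients `η` and conformal factors `f`. -/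
noncomputable def lE (ε : Fin 3 → ℝ) (η : Fin 3 → Fin 3 → ℝ) (f : Fin 3 → ℝ)
    (s t : Fin 3) : ℝ :=
  Real.sqrt (ε s * exp (2 * f s) + ε t * exp (2 * f t) + 2 * η s t * exp (f s + f t))

/-- The admissible space `Ω^E_{ijk}`: conformal factors for which the three edge lengths
satisfy the three strict triangle inequalities. -/
def OmegaE (ε : Fin 3 → ℝ) (η : Fin 3 → Fin 3 → ℝ) : Set (Fin 3 → ℝ) :=
  {f | ∀ s t r : Fin 3, s ≠ t → s ≠ r → t ≠ r →
    lE ε η f s t + lE ε η f s r > lE ε η f t r}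

/-- The inner angle at the vertex `a` of the Euclidean triangle, via the law of cosines.
The two other vertices of the triangle are `a + 1` and `a + 2` (cyclically in `Fin 3`). -/
noncomputable def thetaE (ε : Fin 3 → ℝ) (η : Fin 3 → Fin 3 → ℝ) (f : Fin 3 → ℝ)
    (a : Fin 3) : ℝ :=
  arccos ((lE ε η f a (a + 1) ^ 2 + lE ε η f a (a + 2) ^ 2 - lE ε η f (a + 1) (a + 2) ^ 2) /
    (2 * lE ε η f a (a + 1) * lE ε η f a (a + 2)))

/-- The structure conditions on the weights of the triangle. -/
def StructCondE (ε : Fin 3 → ℝ) (η : Fin 3 → Fin 3 → ℝ) : Prop :=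
  (∀ s, ε s = 0 ∨ ε s = 1) ∧ (∀ s t, η s t = η t s) ∧
  (∀ s t : Fin 3, s ≠ t → ε s * ε t + η s t > 0) ∧
  (∀ q s t : Fin 3, q ≠ s → q ≠ t → s ≠ t → ε q * η s t + η q s * η q t ≥ 0)

open Classical in
/-- The extended angle function: equal to the inner angle `θ_a` on the admissible space,
and for non-admissible `f` equal to `π` at the vertex `a` whose opposite edge length
dominates the sum of the two adjacent ones, and `0` at the other two vertices. -/
noncomputable def thetaExE (ε : Fin 3 → ℝ) (η : Fin 3 → Fin 3 → ℝ) (f : Fin 3 → ℝ)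
    (a : Fin 3) : ℝ :=
  if f ∈ OmegaE ε η then thetaE ε η f a
  else if lE ε η f (a + 1) (a + 2) ≥ lE ε η f a (a + 1) + lE ε η f a (a + 2) then π else 0

lemma lE_comm {ε : Fin 3 → ℝ} {η : Fin 3 → Fin 3 → ℝ} (hη : ∀ s t, η s t = η t s)
    (f : Fin 3 → ℝ) (s t : Fin 3) : lE ε η f s t = lE ε η f t s := by
  unfold lE
  rw [hη s t, add_comm (f s) (f t), add_comm (ε s * _)]

lemma lE_pos {ε : Fin 3 → ℝ} {η : Fin 3 → Fin 3 → ℝ} (h : StructCondE ε η)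
    (f : Fin 3 → ℝ) {s t : Fin 3} (hst : s ≠ t) : 0 < lE ε η f s t := by
  obtain ⟨hε, -, hpos, -⟩ := h
  have hp := hpos s t hst
  have hx := exp_pos (f s)
  have hy := exp_pos (f t)
  have hxy := mul_pos hx hy
  apply Real.sqrt_pos.mpr
  rw [two_mul (f s), two_mul (f t), exp_add, exp_add, exp_add]
  have hη := mul_pos hp hxy
  rcases hε s with hs | hs <;> rcases hε t with ht | ht <;> rw [hs, ht] at hη ⊢ <;>
    nlinarith [sq_nonneg (exp (f s) - exp (f t)), mul_pos hx hx, mul_pos hy hy]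

lemma continuous_lE (ε : Fin 3 → ℝ) (η : Fin 3 → Fin 3 → ℝ) (s t : Fin 3) :
    Continuous fun f => lE ε η f s t := by
  unfold lE
  fun_prop

lemma continuous_thetaE {ε : Fin 3 → ℝ} {η : Fin 3 → Fin 3 → ℝ} (h : StructCondE ε η)
    (a : Fin 3) : Continuous fun f => thetaE ε η f a := by
  have h₁ : a ≠ a + 1 := by fin_cases a <;> decide
  have h₂ : a ≠ a + 2 := by fin_cases a <;> decide
  have c₁ := continuous_lE ε η a (a + 1)
  have c₂ := continuous_lE ε η a (a + 2)
  have c₃ := continuous_lE ε η (a + 1) (a + 2)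
  refine continuous_arccos.comp (Continuous.div (by fun_prop) (by fun_prop) fun f => ?_)
  have := lE_pos h f h₁
  have := lE_pos h f h₂
  positivity

/-- The law-of-cosines angle is `π` when the opposite side is too long. -/
lemma arccos_cosine_law_eq_pi {x y z : ℝ} (hx : 0 < x) (hy : 0 < y) (h : x + y ≤ z) :
    arccos ((x ^ 2 + y ^ 2 - z ^ 2) / (2 * x * y)) = π := by
  apply arccos_of_le_neg_one
  rw [div_le_iff₀ (by positivity)]
  nlinarith

/-- The law-of-cosines angle is `0` when one of the adjacent sides is too long. -/
lemma arccos_cosine_law_eq_zero {x y z : ℝ} (hx : 0 < x) (hy : 0 < y) (hz : 0 < z)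
    (h : y + z ≤ x ∨ x + z ≤ y) :
    arccos ((x ^ 2 + y ^ 2 - z ^ 2) / (2 * x * y)) = 0 := by
  apply arccos_of_one_le
  rw [le_div_iff₀ (by positivity)]
  rcases h with h | h <;> nlinarith

/-- Since `arccos` is constant outside `[-1, 1]`, the extended angle is given by the law of
cosines for every `f`. -/
lemma thetaExE_eq_thetaE {ε : Fin 3 → ℝ} {η : Fin 3 → Fin 3 → ℝ} (h : StructCondE ε η)
    (f : Fin 3 → ℝ) (a : Fin 3) : thetaExE ε η f a = thetaE ε η f a := by
  have h₁ : a ≠ a + 1 := by fin_cases a <;> decide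
  have h₂ : a ≠ a + 2 := by fin_cases a <;> decide
  have h₃ : a + 1 ≠ a + 2 := by fin_cases a <;> decide
  have p₁ := lE_pos h f h₁
  have p₂ := lE_pos h f h₂
  have p₃ := lE_pos h f h₃
  unfold thetaExE
  split_ifs with hΩ hπ
  · rfl
  · exact (arccos_cosine_law_eq_pi p₁ p₂ hπ).symm
  · refine (arccos_cosine_law_eq_zero p₁ p₂ p₃ ?_).symm
    by_contra! hlt
    refine hΩ fun s t r hst hsr htr => ?_
    have e₁ := lE_comm (ε := ε) h.2.1 f 0 1
    have e₂ := lE_comm (ε := ε) h.2.1 f 0 2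
    have e₃ := lE_comm (ε := ε) h.2.1 f 1 2
    fin_cases a <;> fin_cases s <;> fin_cases t <;> fin_cases r <;> simp at * <;> linarith

/-- Under the structure conditions, the extended angle functions
`θ̃_i, θ̃_j, θ̃_k : ℝ³ → ℝ` (equal to the genuine angles on `Ω^E_{ijk}`, and equal to
`π` resp. `0` on the degenerate region) are continuous on all of `ℝ³`. -/
theorem euclidean_extended_angles_continuous (ε : Fin 3 → ℝ) (η : Fin 3 → Fin 3 → ℝ)
    (hstruct : StructCondE ε η) :
    (∀ a : Fin 3, Continuous fun f => thetaExE ε η f a) ∧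
    (∀ f ∈ OmegaE ε η, ∀ a, thetaExE ε η f a = thetaE ε η f a) := by
  refine ⟨fun a => ?_, fun f _ a => thetaExE_eq_thetaE hstruct f a⟩
  simpa only [thetaExE_eq_thetaE hstruct] using continuous_thetaE hstruct a
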